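/- arXiv:1109.3044 — 5 statements merged into one kernel-verified Lean document; each statement's English description precedes it below -/
import Mathlib

section
/- Let R be a ring, M a faithful left R-module, and T a two-sided ideal of R. Then T is M-dense in R if and only if M is a unital T-module, i.e. for every m ∈ M there exists t ∈ T with t•m = m. (Proposition 1.1(a), equivalence (i)⇔(ii).) -/
/-- A two-sided ideal `T` of `R` is `M`-dense in `R` (density in the `M`-adic
topology) if for every `a ∈ R` and every finite set of elements of `M` there is
`b ∈ T` acting like `a` on those elements. -/
def TwoSidedIdeal.IsMDense {R : Type*} [Ring R] (T : TwoSidedIdeal R)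
    (M : Type*) [AddCommGroup M] [Module R M] : Prop :=
  ∀ (a : R) (s : Finset M), ∃ b ∈ T, ∀ m ∈ s, a • m = b • m

/-- If every single element of `M` is fixed by some element of `T`, then so is every finite set of
elements, simultaneously. -/
theorem TwoSidedIdeal.exists_mem_forall_smul_eq_self {R : Type*} [Ring R] {M : Type*}
    [AddCommGroup M] [Module R M] {T : TwoSidedIdeal R}
    (h : ∀ m : M, ∃ t ∈ T, t • m = m) (s : Finset M) :
    ∃ t ∈ T, ∀ m ∈ s, t • m = m := by
  classical
  induction s using Finset.induction_on with
  | empty => exact ⟨0, T.zero_mem, by simp⟩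
  | insert x s _ ih =>
    obtain ⟨t, ht, hts⟩ := ih
    obtain ⟨u, hu, hux⟩ := h (x - t • x)
    have key (m : M) (hm : u • (m - t • m) = m - t • m) : (t + u - u * t) • m = m := by
      rw [sub_smul, add_smul, mul_smul, add_sub_assoc, ← smul_sub, hm, add_sub_cancel]
    refine ⟨t + u - u * t, T.sub_mem (T.add_mem ht hu) (T.mul_mem_left u t ht), fun m hm ↦ ?_⟩
    rcases Finset.mem_insert.mp hm with rfl | hm
    · exact key m hux
    · exact key m (by simp [hts m hm])

/-- Proposition 1.1(a), (i)⇔(ii): for a faithful module `M`, a two-sided ideal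
`T` is `M`-dense iff `M` is a unital `T`-module. -/
theorem twoSidedIdeal_isMDense_iff_unital {R : Type*} [Ring R]
    (M : Type*) [AddCommGroup M] [Module R M]
    (hfaith : ∀ r : R, (∀ m : M, r • m = 0) → r = 0)
    (T : TwoSidedIdeal R) :
    T.IsMDense M ↔ ∀ m : M, ∃ t ∈ T, t • m = m := by
  refine ⟨fun h m ↦ ?_, fun h a s ↦ ?_⟩
  · obtain ⟨b, hb, hbm⟩ := h 1 {m}
    exact ⟨b, hb, by simpa using (hbm m (Finset.mem_singleton_self m)).symm⟩
  · obtain ⟨t, ht, hts⟩ := TwoSidedIdeal.exists_mem_forall_smul_eq_self h s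
    exact ⟨a * t, T.mul_mem_left a t ht, fun m hm ↦ by rw [mul_smul, hts m hm]⟩
end

section
/- Let R be a ring and M a left R-module such that the trace functor Tᴹ is exact, i.e. f(Tᴹ(A)) = Tᴹ(B) for every surjective R-linear map f : A → B of left R-modules. Let N be a left R-module subgenerated by M, and let p : X → N be a surjective R-linear map from a left R-module X whose kernel is small (superfluous) in X. Then X is subgenerated by M. (Proposition 1.2(i): σ[M] is closed under small epimorphisms.) -/
universe u v w

/-- `N` is subgenerated by `M` (i.e. `N ∈ σ[M]`) if `N` embeds, as an
`R`-module, into a quotient of a direct sum `M^(I)` of copies of `M`. -/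
def IsSubgenerated (R : Type u) [Ring R] (M : Type v) [AddCommGroup M] [Module R M]
    (N : Type w) [AddCommGroup N] [Module R N] : Prop :=
  ∃ (I : Type (max v w)) (K : Submodule R (I →₀ M)) (f : N →ₗ[R] ((I →₀ M) ⧸ K)),
    Function.Injective f

/-- The trace `Tᴹ(N)` of `M` in `N`: the sum of all submodules of `N` that are
subgenerated by `M`. -/
def traceSubmodule (R : Type u) [Ring R] (M : Type v) [AddCommGroup M] [Module R M]
    (N : Type w) [AddCommGroup N] [Module R N] : Submodule R N :=
  sSup {P : Submodule R N | IsSubgenerated R M ↥P}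

/-- A quotient of a module that embeds into a direct sum of copies of `M` is subgenerated by `M`. -/
theorem IsSubgenerated.of_injective_of_surjective {R : Type u} [Ring R]
    {M : Type v} [AddCommGroup M] [Module R M] {N : Type w} [AddCommGroup N] [Module R N]
    {I : Type (max v w)} {D : Type*} [AddCommGroup D] [Module R D]
    (j : D →ₗ[R] I →₀ M) (hj : Function.Injective j)
    (g : D →ₗ[R] N) (hg : Function.Surjective g) : IsSubgenerated R M N := by
  refine ⟨I, (LinearMap.ker g).map j,
    (LinearMap.ker g).mapQ _ j (Submodule.le_comap_map _ _) ∘ₗ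
      (g.quotKerEquivOfSurjective hg).symm.toLinearMap, ?_⟩
  rw [LinearMap.coe_comp]
  refine Function.Injective.comp ?_ (LinearEquiv.injective _)
  rw [← LinearMap.ker_eq_bot, Submodule.ker_mapQ, Submodule.comap_map_eq_of_injective hj,
    Submodule.mkQ_map_self]

/-- A module subgenerated by `M` is a quotient of a submodule of a direct sum of copies of `M`. -/
theorem IsSubgenerated.exists_surjective {R : Type u} [Ring R]
    {M : Type v} [AddCommGroup M] [Module R M] {N : Type w} [AddCommGroup N] [Module R N]
    (h : IsSubgenerated R M N) :
    ∃ (I : Type (max v w)) (U : Submodule R (I →₀ M)) (g : U →ₗ[R] N),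
      Function.Surjective g := by
  obtain ⟨I, K, f, hf⟩ := h
  refine ⟨I, (LinearMap.range f).comap K.mkQ,
    (LinearEquiv.ofInjective f hf).symm.toLinearMap ∘ₗ
      K.mkQ.restrict (p := (LinearMap.range f).comap K.mkQ) fun _ hx => hx, ?_⟩
  rw [LinearMap.coe_comp]
  refine (LinearEquiv.surjective _).comp ?_
  rintro ⟨y, hy⟩
  obtain ⟨x, rfl⟩ := K.mkQ_surjective y
  exact ⟨⟨x, hy⟩, rfl⟩

/-- Subgeneration by `M` is invariant under isomorphism. -/
theorem IsSubgenerated.of_linearEquiv {R : Type u} [Ring R]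
    {M : Type v} [AddCommGroup M] [Module R M]
    {N N' : Type w} [AddCommGroup N] [Module R N] [AddCommGroup N'] [Module R N']
    (h : IsSubgenerated R M N) (e : N' ≃ₗ[R] N) : IsSubgenerated R M N' := by
  obtain ⟨I, K, f, hf⟩ := h
  exact ⟨I, K, f ∘ₗ e.toLinearMap, hf.comp e.injective⟩

/-- A sum of submodules subgenerated by `M` is subgenerated by `M`. -/
theorem IsSubgenerated.of_iSup_eq_top {R : Type u} [Ring R]
    {M : Type v} [AddCommGroup M] [Module R M] {X : Type w} [AddCommGroup X] [Module R X]
    {ι : Type w} (P : ι → Submodule R X) (hP : ∀ i, IsSubgenerated R M (P i))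
    (htop : ⨆ i, P i = ⊤) : IsSubgenerated R M X := by
  classical
  choose I U g hg using fun i => (hP i).exists_surjective
  refine .of_injective_of_surjective (D := Π₀ i, U i) (I := Σ i, I i)
    ((sigmaFinsuppLequivDFinsupp R).symm.toLinearMap ∘ₗ
      DFinsupp.mapRange.linearMap fun i => (U i).subtype) ?_
    (DFinsupp.lsum ℕ fun i => (P i).subtype ∘ₗ g i) ?_
  · rw [LinearMap.coe_comp]
    refine (LinearEquiv.injective _).comp ?_
    exact (DFinsupp.mapRange_injective _ fun i => map_zero (U i).subtype).2
      fun i => (U i).injective_subtype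
  · rw [← LinearMap.range_eq_top, eq_top_iff, ← htop, iSup_le_iff]
    intro i x hx
    obtain ⟨y, hy⟩ := hg i ⟨x, hx⟩
    exact ⟨DFinsupp.single i y, by simp [hy]⟩

/-- The trace of `M` in `N` is all of `N` exactly when `N` is subgenerated by `M`. -/
theorem traceSubmodule_eq_top_iff {R : Type u} [Ring R]
    {M : Type v} [AddCommGroup M] [Module R M] {N : Type w} [AddCommGroup N] [Module R N] :
    traceSubmodule R M N = ⊤ ↔ IsSubgenerated R M N := by
  constructor
  · intro h
    rw [traceSubmodule, sSup_eq_iSup'] at h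
    exact .of_iSup_eq_top _ (fun P => P.2) h
  · intro h
    exact top_le_iff.1 (le_sSup (h.of_linearEquiv Submodule.topEquiv))

/-- Proposition 1.2(i): if the trace functor `Tᴹ` is exact, then `σ[M]` is
closed under small (superfluous) epimorphisms: if `p : X → N` is surjective with
small kernel and `N ∈ σ[M]`, then `X ∈ σ[M]`. -/
theorem isSubgenerated_of_small_epi {R : Type u} [Ring R]
    (M : Type v) [AddCommGroup M] [Module R M]
    (hexact : ∀ (A : Type w) (B : Type w) [AddCommGroup A] [Module R A]
      [AddCommGroup B] [Module R B] (f : A →ₗ[R] B), Function.Surjective f →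
        Submodule.map f (traceSubmodule R M A) = traceSubmodule R M B)
    (N : Type w) [AddCommGroup N] [Module R N] (hN : IsSubgenerated R M N)
    (X : Type w) [AddCommGroup X] [Module R X] (p : X →ₗ[R] N)
    (hp : Function.Surjective p)
    (hsmall : ∀ L : Submodule R X, LinearMap.ker p ⊔ L = ⊤ → L = ⊤) :
    IsSubgenerated R M X := by
  rw [← traceSubmodule_eq_top_iff] at hN ⊢
  apply hsmall
  rw [sup_comm, ← Submodule.comap_map_eq, hexact X N p hp, hN, Submodule.comap_top]
end

section
/- Let R be a ring, T an injective right R-module, and u : X → Y an injective R-linear map of right R-modules. If V ⊆ Hom_R(Y,T) is dense in Hom_R(Y,T) in the finite topology, then its image Hom_R(u,T)(V) = {v∘u : v ∈ V} ⊆ Hom_R(X,T) is dense in Hom_R(X,T) in the finite topology. (Proposition 1.5.) -/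
universe u v

/-- A subset `X ⊆ Hom_R(M,T)` is dense in the finite topology if every
`R`-linear map `M → T` can be matched on any finite subset of `M` by an
element of `X`. -/
def DenseFin {R : Type*} [Ring R] {M T : Type*} [AddCommGroup M] [Module R M]
    [AddCommGroup T] [Module R T] (X : Set (M →ₗ[R] T)) : Prop :=
  ∀ (f : M →ₗ[R] T) (F : Finset M), ∃ g ∈ X, ∀ m ∈ F, g m = f m

/-- Proposition 1.5: if `T` is an injective module, `u : X → Y` is a
monomorphism, and `V ⊆ Hom_R(Y,T)` is dense in the finite topology, then
`Hom_R(u,T)(V) = {v∘u : v ∈ V}` is dense in `Hom_R(X,T)`. -/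
theorem denseFin_comp_of_denseFin {R : Type u} [Ring R]
    {T : Type v} [AddCommGroup T] [Module R T]
    (hTinj : ∀ (A B : Type v) [AddCommGroup A] [Module R A] [AddCommGroup B]
      [Module R B] (w : A →ₗ[R] B), Function.Injective w →
        ∀ f : A →ₗ[R] T, ∃ g : B →ₗ[R] T, g.comp w = f)
    {X Y : Type v} [AddCommGroup X] [Module R X] [AddCommGroup Y] [Module R Y]
    (u : X →ₗ[R] Y) (hu : Function.Injective u)
    (V : Set (Y →ₗ[R] T)) (hV : DenseFin V) :
    DenseFin {w : X →ₗ[R] T | ∃ v ∈ V, w = v.comp u} := by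
  classical
  intro f F
  obtain ⟨g, rfl⟩ := hTinj X Y u hu f
  obtain ⟨v, hvV, hv⟩ := hV g (F.image u)
  exact ⟨v.comp u, ⟨v, hvV, rfl⟩, fun m hm => hv (u m) (Finset.mem_image_of_mem u hm)⟩
end

section
/- Let R be a quasi-Frobenius ring and M a left R-module. Then the image of the canonical map Φ_M : M → (*M)* is dense in (*M)* with respect to the finite topology: for every T ∈ (*M)* = Hom_R(*M, R) and every finite list f₁,…,fₙ ∈ *M = Hom_R(M,R) there exists m ∈ M such that T(fᵢ) = fᵢ(m) for all i = 1,…,n. (Lemma 1.6.) -/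
universe u v

/-- Evaluation at `m`, as a right `R`-linear functional on the dual of a left `R`-module. -/
def evalRight (R : Type u) [Ring R] {M : Type v} [AddCommGroup M] [Module R M] (m : M) :
    (M →ₗ[R] R) →ₗ[Rᵐᵒᵖ] R where
  toFun f := f m
  map_add' _ _ := rfl
  map_smul' _ _ := rfl

/-- On an Artinian module, finitely many members of a jointly injective family of linear maps are
already jointly injective. -/
theorem exists_finset_forall_apply_eq_zero_imp {S : Type*} [Ring S] {V W : Type*} [AddCommGroup V]
    [Module S V] [IsArtinian S V] [AddCommGroup W] [Module S W] {ι : Type*} (φ : ι → V →ₗ[S] W)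
    (h : ⨅ i, LinearMap.ker (φ i) = ⊥) :
    ∃ t : Finset ι, ∀ x, (∀ i ∈ t, φ i x = 0) → x = 0 := by
  obtain ⟨t, ht⟩ := Finset.exists_inf_le fun i => LinearMap.ker (φ i)
  refine ⟨t, fun x hx => ?_⟩
  have hmem : x ∈ ⨅ i, LinearMap.ker (φ i) :=
    (Submodule.mem_iInf _).2 fun i => ht i (Submodule.mem_finsetInf.2 hx)
  simpa [h] using hmem

/-- Lemma 1.6: over a quasi-Frobenius ring `R` (right Artinian and injective as
a right `R`-module), for any left `R`-module `M` the image of the canonical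
evaluation map `Φ_M : M → (*M)*` is dense in `(*M)* = Hom_R(*M, R)` in the
finite topology: for every right `R`-linear `T : *M → R` and every finite set
of elements of `*M = Hom_R(M,R)` there is `m ∈ M` with `T(f) = f(m)` for all
`f` in the finite set.  (Here `*M = Hom_R(M,R)` is a right `R`-module, i.e. a
left `Rᵐᵒᵖ`-module.) -/
theorem image_eval_dense_of_quasiFrobenius {R : Type u} [Ring R]
    (hart : IsArtinian Rᵐᵒᵖ Rᵐᵒᵖ)
    (hinj : ∀ (A B : Type u) [AddCommGroup A] [Module Rᵐᵒᵖ A] [AddCommGroup B]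
      [Module Rᵐᵒᵖ B] (w : A →ₗ[Rᵐᵒᵖ] B), Function.Injective w →
        ∀ f : A →ₗ[Rᵐᵒᵖ] R, ∃ g : B →ₗ[Rᵐᵒᵖ] R, g.comp w = f)
    (M : Type v) [AddCommGroup M] [Module R M]
    (T : (M →ₗ[R] R) →ₗ[Rᵐᵒᵖ] R) (s : Finset (M →ₗ[R] R)) :
    ∃ m : M, ∀ f ∈ s, T f = f m := by
  let V := Submodule.span Rᵐᵒᵖ (s : Set (M →ₗ[R] R))
  have : IsArtinian Rᵐᵒᵖ V := isArtinian_span_of_finite Rᵐᵒᵖ s.finite_toSet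
  obtain ⟨t, ht⟩ := exists_finset_forall_apply_eq_zero_imp (S := Rᵐᵒᵖ) (V := V) (W := R)
      (fun m : M => (evalRight R m).comp V.subtype) <| by
    refine (Submodule.eq_bot_iff _).2 fun f hf => ?_
    rw [Submodule.mem_iInf] at hf
    exact Subtype.ext (LinearMap.ext fun m => hf m)
  let e : Fin t.card → M := fun j => t.equivFin.symm j
  let Φ : V →ₗ[Rᵐᵒᵖ] (Fin t.card → R) :=
    LinearMap.pi fun j => (evalRight R (e j)).comp V.subtype
  have hΦ : Function.Injective Φ := by
    refine LinearMap.ker_eq_bot.1 (LinearMap.ker_eq_bot'.2 fun f hf => ht f fun m hm => ?_)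
    simpa [Φ, e] using congrFun hf (t.equivFin ⟨m, hm⟩)
  let E := LinearEquiv.ofInjective Φ hΦ
  obtain ⟨g, hg⟩ := hinj (LinearMap.range Φ) (Fin t.card → R) (LinearMap.range Φ).subtype
    Subtype.val_injective ((T.comp V.subtype).comp E.symm.toLinearMap)
  refine ⟨∑ j, g (Pi.single j 1) • e j, fun f hf => ?_⟩
  let f' : V := ⟨f, Submodule.subset_span hf⟩
  have hgf : g (Φ f') = T f := by
    simpa [E, f'] using LinearMap.congr_fun hg (E f')
  have hsum : Φ f' = ∑ j, MulOpposite.op (f (e j)) • (Pi.single j 1 : Fin t.card → R) := by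
    ext k
    simp [Φ, f', evalRight, Finset.sum_apply, Pi.single_apply]
  rw [← hgf, hsum]
  simp [map_sum]
end

section
/- Let R be a ring, P an Artinian projective left R-module, M a left R-module, and f : P → M a surjective R-linear map. Then there exist submodules Y and K' of P with K' ⊆ ker f, P = Y ⊕ K' (i.e. Y + K' = P and Y ∩ K' = 0), such that the restriction f|_Y : Y → M is surjective and its kernel Y ∩ ker f is small (superfluous) in Y. In particular, M has a projective cover which is a direct summand of P. (The dualized Eckmann–Schopf argument established in the proof of Theorem 3.1, implication (iv)⇒(iii).) -/
/-- The dualized Eckmann–Schopf argument from the proof of Theorem 3.1,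
(iv)⇒(iii): if `P` is an Artinian projective left `R`-module and `f : P → M`
is a surjective `R`-linear map, then there are submodules `Y, K'` of `P` with
`K' ⊆ ker f`, `P = Y ⊕ K'`, the restriction `f|_Y : Y → M` surjective with
small (superfluous) kernel `Y ∩ ker f` in `Y`; in particular `Y` is projective,
so `M` has a projective cover which is a direct summand of `P`. -/
theorem exists_projective_cover_summand_of_artinian_projective
    {R : Type*} [Ring R] {P : Type*} [AddCommGroup P] [Module R P]
    [IsArtinian R P] (hPproj : Module.Projective R P)
    {M : Type*} [AddCommGroup M] [Module R M]
    (f : P →ₗ[R] M) (hf : Function.Surjective f) :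
    ∃ Y K' : Submodule R P,
      K' ≤ LinearMap.ker f ∧
      Y ⊔ K' = ⊤ ∧ Y ⊓ K' = ⊥ ∧
      Submodule.map f Y = ⊤ ∧
      (∀ L ≤ Y, (Y ⊓ LinearMap.ker f) ⊔ L = Y → L = Y) ∧
      Module.Projective R ↥Y := by
  -- `Y` is minimal among the submodules that `f` maps onto `M`.
  obtain ⟨Y, hY, hYmin⟩ := WellFounded.has_min (wellFounded_lt (α := Submodule R P))
    {Y | Submodule.map f Y = ⊤} ⟨⊤, by simpa using LinearMap.range_eq_top.2 hf⟩
  have eq_of_le : ∀ L ≤ Y, Submodule.map f L = ⊤ → L = Y := fun L hL h ↦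
    hL.eq_of_not_lt (hYmin L h)
  have hY' : Submodule.map f Y = ⊤ := hY
  have hker : Y ⊔ LinearMap.ker f = ⊤ := by
    rw [← Submodule.comap_map_eq, hY', Submodule.comap_top]
  -- `K` is minimal among the submodules of `ker f` that supplement `Y`.
  obtain ⟨K, ⟨hKf, hYK⟩, hKmin⟩ := WellFounded.has_min (wellFounded_lt (α := Submodule R P))
    {K | K ≤ LinearMap.ker f ∧ Y ⊔ K = ⊤} ⟨_, le_rfl, hker⟩
  have hsurj : Function.Surjective (K.mkQ ∘ₗ Y.subtype) := by
    rw [← LinearMap.range_eq_top, LinearMap.range_comp, Submodule.range_subtype,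
      ← Submodule.comap_injective_of_surjective K.mkQ_surjective |>.eq_iff,
      Submodule.comap_map_mkQ, sup_comm, hYK, Submodule.comap_top]
  obtain ⟨ψ, hψ⟩ := Module.projective_lifting_property _ K.mkQ hsurj
  have hsub : ∀ p, (ψ p : P) - p ∈ K := fun p ↦
    (Submodule.Quotient.eq K).1 (LinearMap.congr_fun hψ p)
  have hfψ : ∀ p, f (ψ p) = f p := fun p ↦ by
    simpa [sub_eq_zero] using hKf (hsub p)
  have hψY : Submodule.map (Y.subtype ∘ₗ ψ) Y = Y := by
    refine eq_of_le _ ?_ ?_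
    · rintro _ ⟨p, -, rfl⟩
      exact (ψ p).2
    · rw [← Submodule.map_comp, ← hY']
      congr 1
      exact LinearMap.ext hfψ
  have hkerK : LinearMap.ker ψ ≤ K := fun p hp ↦ by
    simpa [LinearMap.mem_ker.1 hp] using hsub p
  have hkerY : Y ⊔ LinearMap.ker ψ = ⊤ := by
    rw [← Submodule.comap_map_eq, eq_top_iff]
    intro p _
    obtain ⟨y, hy, hyp⟩ := hψY.ge (ψ p).2
    exact ⟨y, hy, Subtype.ext hyp⟩
  have hKeq : LinearMap.ker ψ = K :=
    hkerK.eq_of_not_lt (hKmin _ ⟨hkerK.trans hKf, hkerY⟩)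
  have hinf : Y ⊓ K = ⊥ := by
    rw [eq_bot_iff]
    rintro y ⟨hy, hyK⟩
    obtain ⟨p, -, rfl⟩ := hψY.ge hy
    have hp : p ∈ K := by simpa using K.sub_mem hyK (hsub p)
    rw [← hKeq, LinearMap.mem_ker] at hp
    simp [hp]
  have hcompl : IsCompl Y K := ⟨disjoint_iff.2 hinf, codisjoint_iff.2 hYK⟩
  refine ⟨Y, K, hKf, hYK, hinf, hY', fun L hL h ↦ eq_of_le L hL ?_, ?_⟩
  · have hbot : Submodule.map f (Y ⊓ LinearMap.ker f) = ⊥ :=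
      (Submodule.map_le_iff_le_comap.2 inf_le_right).antisymm bot_le
    rw [← hY', ← h, Submodule.map_sup, hbot, bot_sup_eq]
  · exact Module.Projective.of_split Y.subtype (Y.projectionOnto K hcompl)
      (Submodule.projectionOnto_comp_subtype hcompl)
end
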